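/- arXiv:2309.02132 — 2 statements merged into one kernel-verified Lean document; each statement's English description precedes it below -/
import Mathlib

section
/- Promising graph, type 4: Suppose that in a play of the (K^{ℵ0}, K^4)-building game it is the first player's turn, and there are six distinct vertices a, b, c, d, e, f such that the edges ab, ac, ad, ae, af, bc are red, the edges bd, ef are blue, and all other edges among {a, b, c, d, e, f} are unclaimed (in particular the vulnerable edges be and bf are unclaimed). Suppose further that on the whole board, even after adding be and bf as blue edges, the blue edges contain no K^4 and admit no blue threat. Then the first player has a winning strategy from this position: each of her moves before the last creates a red threat, and she completes a red K^4 within at most 4 further moves of hers (she claims ce, then after the forced reply be she claims cf, and after the forced reply bf she claims cd, creating two red threats at once). -/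
/-!
Positions in the `(K^{ℵ₀}, K^4)`-building game.  A position is a pair `(R, B)`
of disjoint finite sets of red (first player's) and blue (second player's)
edges of the complete graph on `ℕ`; an edge is unclaimed if it lies in neither
set.
-/

/-- A history of further moves played from a position, in chronological order;
the player to move plays at even indices, the other player at odd indices. -/
abbrev Hist : Type := List (Sym2 ℕ)

/-- A strategy: assigns to each sequence of previously claimed edges an edge. -/
abbrev Strategy : Type := Hist → Sym2 ℕ

/-- The edges claimed at even indices of a history. -/
def firstPlayerEdges (h : Hist) : Set (Sym2 ℕ) :=
  {x | ∃ i : Fin h.length, (i : ℕ) % 2 = 0 ∧ h.get i = x}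

/-- The edges claimed at odd indices of a history. -/
def secondPlayerEdges (h : Hist) : Set (Sym2 ℕ) :=
  {x | ∃ i : Fin h.length, (i : ℕ) % 2 = 1 ∧ h.get i = x}

/-- The red edges after the further moves `h` have been played from a position
with red edges `R`, the first player (red) moving at even indices. -/
def redAfter (R : Finset (Sym2 ℕ)) (h : Hist) : Set (Sym2 ℕ) :=
  ↑R ∪ firstPlayerEdges h

/-- The blue edges after the further moves `h` have been played from a
position with blue edges `B`, the second player (blue) moving at odd
indices. -/
def blueAfter (B : Finset (Sym2 ℕ)) (h : Hist) : Set (Sym2 ℕ) :=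
  ↑B ∪ secondPlayerEdges h

/-- An edge is a legal move if it is a proper edge (not a loop) and is
unclaimed, i.e. lies neither in the position `(R, B)` nor in the history `h`
of further moves. -/
def LegalFrom (R B : Finset (Sym2 ℕ)) (h : Hist) (x : Sym2 ℕ) : Prop :=
  ¬ x.IsDiag ∧ x ∉ R ∧ x ∉ B ∧ x ∉ h

/-- The history of further moves after `n` moves, when the player to move
follows the strategy `σ` and the other player follows the strategy `τ`. -/
def play (σ τ : Strategy) : ℕ → Hist
  | 0 => []
  | n + 1 => play σ τ n ++ [if n % 2 = 0 then σ (play σ τ n) else τ (play σ τ n)]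

/-- `E` contains all six edges on some 4-element vertex set. -/
def HasK4 (E : Set (Sym2 ℕ)) : Prop :=
  ∃ t : Finset ℕ, t.card = 4 ∧ ∀ u ∈ t, ∀ v ∈ t, u ≠ v → s(u, v) ∈ E

/-- A threat for the colour with edge set `C`, the other colour having edge
set `O`: a 4-element vertex set `t` on which the edge `x` is unclaimed while
all five other edges belong to `C`. -/
def IsThreat (C O : Set (Sym2 ℕ)) (t : Finset ℕ) (x : Sym2 ℕ) : Prop :=
  t.card = 4 ∧ (∃ u ∈ t, ∃ v ∈ t, u ≠ v ∧ x = s(u, v)) ∧ x ∉ C ∧ x ∉ O ∧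
    ∀ u ∈ t, ∀ v ∈ t, u ≠ v → s(u, v) ≠ x → s(u, v) ∈ C

/-- The colour with edge set `C` admits a threat (the other colour having edge
set `O`). -/
def HasThreat (C O : Set (Sym2 ℕ)) : Prop := ∃ t x, IsThreat C O t x

/-- From the position `(R, B)` with the first player (red) to move, the first
player has a winning strategy which completes a red `K^4` within at most
`(bound + 1) / 2` further moves of hers, each of her moves before the last
creating a red threat: against every legally playing opponent there is an odd
stage `n ≤ bound` (a stage just after one of her own moves, her `r`-th further
move being move number `2 * r - 1`) at which, all of her moves having been
legal and each of her moves before the last having created a red threat, the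
red edges contain a `K^4` while the blue edges do not. -/
def WinsFromWithinThreats (R B : Finset (Sym2 ℕ)) (bound : ℕ) : Prop :=
  ∃ σ : Strategy, ∀ τ : Strategy,
    (∀ n, n % 2 = 1 → (∃ x, LegalFrom R B (play σ τ n) x) →
      LegalFrom R B (play σ τ n) (τ (play σ τ n))) →
    ∃ n ≤ bound, n % 2 = 1 ∧
      (∀ m < n, m % 2 = 0 → LegalFrom R B (play σ τ m) (σ (play σ τ m))) ∧
      (∀ m, m % 2 = 0 → m + 1 < n →
        HasThreat (redAfter R (play σ τ (m + 1)))
          (blueAfter B (play σ τ (m + 1)))) ∧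
      HasK4 (redAfter R (play σ τ n)) ∧ ¬ HasK4 (blueAfter B (play σ τ n))

theorem firstPlayerEdges_nil : firstPlayerEdges [] = ∅ := by
  ext x
  simp [firstPlayerEdges]

theorem secondPlayerEdges_nil : secondPlayerEdges [] = ∅ := by
  ext x
  simp [secondPlayerEdges]

theorem firstPlayerEdges_cons (y : Sym2 ℕ) (h : Hist) :
    firstPlayerEdges (y :: h) = insert y (secondPlayerEdges h) := by
  ext x
  simp only [firstPlayerEdges, secondPlayerEdges, Set.mem_ofPred_eq, Set.mem_insert_iff]
  rw [show (∃ i : Fin (y :: h).length, (i : ℕ) % 2 = 0 ∧ (y :: h).get i = x) ↔ _ from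
    Fin.exists_fin_succ]
  refine or_congr (by simp [eq_comm]) (exists_congr fun i => and_congr ?_ (by simp))
  simp only [Fin.val_succ]
  omega

theorem secondPlayerEdges_cons (y : Sym2 ℕ) (h : Hist) :
    secondPlayerEdges (y :: h) = firstPlayerEdges h := by
  ext x
  simp only [firstPlayerEdges, secondPlayerEdges, Set.mem_ofPred_eq]
  rw [show (∃ i : Fin (y :: h).length, (i : ℕ) % 2 = 1 ∧ (y :: h).get i = x) ↔ _ from
    Fin.exists_fin_succ]
  rw [or_iff_right (by simp)]
  refine exists_congr fun i => and_congr ?_ (by simp)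
  simp only [Fin.val_succ]
  omega

theorem HasK4.mono {E F : Set (Sym2 ℕ)} (hEF : E ⊆ F) (h : HasK4 E) : HasK4 F := by
  obtain ⟨t, ht, hE⟩ := h
  exact ⟨t, ht, fun u hu v hv huv => hEF (hE u hu v hv huv)⟩

/-- A colour with neither a `K^4` nor a threat does not complete a `K^4` by claiming an edge
that does not belong to the other colour. -/
theorem not_hasK4_insert {C O : Set (Sym2 ℕ)} {x : Sym2 ℕ} (hK : ¬ HasK4 C)
    (hT : ¬ HasThreat C O) (hx : x ∉ O) : ¬ HasK4 (insert x C) := by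
  rintro ⟨t, ht, hE⟩
  by_cases hxC : x ∈ C
  · rw [Set.insert_eq_of_mem hxC] at hE
    exact hK ⟨t, ht, hE⟩
  by_cases hxt : ∃ u ∈ t, ∃ v ∈ t, u ≠ v ∧ x = s(u, v)
  · exact hT ⟨t, x, ht, hxt, hxC, hx, fun u hu v hv huv hne =>
      (hE u hu v hv huv).resolve_left hne⟩
  · exact hK ⟨t, ht, fun u hu v hv huv => (hE u hu v hv huv).resolve_left
      fun h => hxt ⟨u, hu, v, hv, huv, h.symm⟩⟩

theorem hasK4_of_edges {E : Set (Sym2 ℕ)} {p q r s : ℕ} (hd : [p, q, r, s].Nodup)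
    (hpq : s(p, q) ∈ E) (hpr : s(p, r) ∈ E) (hps : s(p, s) ∈ E)
    (hqr : s(q, r) ∈ E) (hqs : s(q, s) ∈ E) (hrs : s(r, s) ∈ E) : HasK4 E := by
  refine ⟨[p, q, r, s].toFinset, List.toFinset_card_of_nodup hd, fun u hu v hv huv => ?_⟩
  simp only [List.mem_toFinset, List.mem_cons, List.not_mem_nil, or_false] at hu hv
  rcases hu with rfl | rfl | rfl | rfl <;> rcases hv with rfl | rfl | rfl | rfl <;>
    first
      | exact absurd rfl huv
      | assumption
      | (rw [Sym2.eq_swap]; assumption)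

theorem hasThreat_of_edges {C O : Set (Sym2 ℕ)} {p q r s : ℕ} (hd : [p, q, r, s].Nodup)
    (hpq : s(p, q) ∈ C) (hpr : s(p, r) ∈ C) (hps : s(p, s) ∈ C)
    (hqr : s(q, r) ∈ C) (hqs : s(q, s) ∈ C) (hC : s(r, s) ∉ C) (hO : s(r, s) ∉ O) :
    HasThreat C O := by
  refine ⟨[p, q, r, s].toFinset, s(r, s), List.toFinset_card_of_nodup hd,
    ⟨r, by simp, s, by simp, by rintro rfl; simp at hd, rfl⟩, hC, hO,
    fun u hu v hv huv hne => ?_⟩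
  simp only [List.mem_toFinset, List.mem_cons, List.not_mem_nil, or_false] at hu hv
  rcases hu with rfl | rfl | rfl | rfl <;> rcases hv with rfl | rfl | rfl | rfl <;>
    first
      | exact absurd rfl huv
      | exact absurd rfl hne
      | exact absurd Sym2.eq_swap hne
      | assumption
      | (rw [Sym2.eq_swap]; assumption)

/-- The first player's strategy: claim `ce`, `cf` and `cd` in turn as long as the second player
answers the first two by `be` and `bf`, and complete a red `K^4` as soon as he leaves a red
threat open. -/
def promisingStrategy (b c d e f : ℕ) : Strategy
  | [_, x] => if x = s(b, e) then s(c, f) else s(b, e)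
  | [_, _, _, x] => if x = s(b, f) then s(c, d) else s(b, f)
  | [_, _, _, _, _, x] => if x = s(d, e) then s(d, f) else s(d, e)
  | _ => s(c, e)

set_option maxHeartbeats 1000000 in
/-- Promising graph of type 4.  Suppose that in a play of the
`(K^{ℵ₀}, K^4)`-building game it is the first player's turn and there are six
distinct vertices `a, b, c, d, e, f` such that the edges
`ab, ac, ad, ae, af, bc` are red, the edges `bd, ef` are blue, and all other
edges among `{a, b, c, d, e, f}` (namely `be, bf, cd, ce, cf, de, df`, in
particular the vulnerable edges `be` and `bf`) are unclaimed.  Suppose further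
that on the whole board, even after adding `be` and `bf` as blue edges, the
blue edges contain no `K^4` and admit no blue threat.  Then the first player
has a winning strategy from this position: each of her moves before the last
creates a red threat, and she completes a red `K^4` within at most 4 further
moves of hers. -/
theorem promising_graph_type_four
    (R B : Finset (Sym2 ℕ)) (hdisj : Disjoint R B)
    (a b c d e f : ℕ)
    (hdist : ({a, b, c, d, e, f} : Finset ℕ).card = 6)
    (hab : s(a, b) ∈ R) (hac : s(a, c) ∈ R) (had : s(a, d) ∈ R)
    (hae : s(a, e) ∈ R) (haf : s(a, f) ∈ R) (hbc : s(b, c) ∈ R)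
    (hbd : s(b, d) ∈ B) (hef : s(e, f) ∈ B)
    (hbe : s(b, e) ∉ R ∧ s(b, e) ∉ B)
    (hbf : s(b, f) ∉ R ∧ s(b, f) ∉ B)
    (hcd : s(c, d) ∉ R ∧ s(c, d) ∉ B)
    (hce : s(c, e) ∉ R ∧ s(c, e) ∉ B)
    (hcf : s(c, f) ∉ R ∧ s(c, f) ∉ B)
    (hde : s(d, e) ∉ R ∧ s(d, e) ∉ B)
    (hdf : s(d, f) ∉ R ∧ s(d, f) ∉ B)
    (hnoblueK4 : ¬ HasK4 (↑B ∪ {s(b, e), s(b, f)}))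
    (hnobluethreat : ¬ HasThreat (↑B ∪ {s(b, e), s(b, f)}) ↑R) :
    WinsFromWithinThreats R B 7 := by
  have hnd : [a, b, c, d, e, f].Nodup := by
    have h : ({a, b, c, d, e, f} : Finset ℕ) = [a, b, c, d, e, f].toFinset := by
      ext
      simp
    rw [h] at hdist
    exact Multiset.toFinset_card_eq_card_iff_nodup.mp hdist
  simp only [List.nodup_cons, List.mem_cons, List.not_mem_nil, or_false, not_or,
    not_false_eq_true, List.nodup_nil, and_true] at hnd
  obtain ⟨⟨nab, nac, nad, nae, naf⟩, ⟨nbc, nbd, nbe, nbf⟩, ⟨ncd, nce, ncf⟩, ⟨nde, ndf⟩, nef⟩ := hnd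
  have blueSafe : ∀ {E : Set (Sym2 ℕ)} (x : Sym2 ℕ), x ∉ R →
      E ⊆ insert x (↑B ∪ {s(b, e), s(b, f)}) → ¬ HasK4 E := fun x hx hE hK =>
    not_hasK4_insert hnoblueK4 hnobluethreat (by simpa using hx) (hK.mono hE)
  refine ⟨promisingStrategy b c d e f, fun τ hτ => ?_⟩
  obtain ⟨P, hP⟩ : ∃ P, play (promisingStrategy b c d e f) τ = P := ⟨_, rfl⟩
  have hP0 : P 0 = [] := by rw [← hP]; rfl
  have hPred : ∀ n, n % 2 = 0 → P (n + 1) = P n ++ [promisingStrategy b c d e f (P n)] := by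
    intro n hn
    rw [← hP, play, if_pos hn]
  have hPblue : ∀ n, n % 2 = 1 → P (n + 1) = P n ++ [τ (P n)] := by
    intro n hn
    rw [← hP, play, if_neg (by omega)]
  rw [hP] at hτ ⊢
  have move0 : promisingStrategy b c d e f (P 0) = s(c, e) := by rw [hP0]; rfl
  have hP1 : P 1 = [s(c, e)] := by rw [hPred 0 rfl, move0, hP0]; rfl
  have legal0 : LegalFrom R B (P 0) s(c, e) := by
    rw [hP0]
    simpa [LegalFrom, hce] using nce
  have threat0 : HasThreat (redAfter R (P 1)) (blueAfter B (P 1)) := by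
    rw [hP1]
    apply hasThreat_of_edges (p := a) (q := c) (r := b) (s := e) <;>
      simp [redAfter, blueAfter, firstPlayerEdges_nil, secondPlayerEdges_nil,
        firstPlayerEdges_cons, secondPlayerEdges_cons] <;> grind [Sym2.eq_swap]
  have reply1 := hτ 1 rfl ⟨s(b, e), by rw [hP1]; simp [LegalFrom]; grind⟩
  have hP2 := hPblue 1 rfl
  generalize τ (P 1) = x at reply1 hP2
  rw [hP1] at reply1 hP2
  replace hP2 : P 2 = [s(c, e), x] := hP2
  by_cases hx : x = s(b, e)
  swap
  · have move2 : promisingStrategy b c d e f (P 2) = s(b, e) := by rw [hP2]; exact if_neg hx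
    have hP3 : P 3 = [s(c, e), x, s(b, e)] := by rw [hPred 2 rfl, move2, hP2]; rfl
    refine ⟨3, by norm_num, rfl, ?_, ?_, ?_, ?_⟩
    · intro m hm hm2
      obtain rfl | rfl : m = 0 ∨ m = 2 := by omega
      · rwa [move0]
      · rw [move2, hP2]
        simp [LegalFrom]
        grind
    · intro m hm2 hm
      obtain rfl : m = 0 := by omega
      exact threat0
    · rw [hP3]
      apply hasK4_of_edges (p := a) (q := c) (r := b) (s := e) <;>
        simp [redAfter, secondPlayerEdges_nil,
          firstPlayerEdges_cons, secondPlayerEdges_cons] <;> grind [Sym2.eq_swap]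
    · rw [hP3]
      refine blueSafe x reply1.2.1 ?_
      intro y
      simp [blueAfter, firstPlayerEdges_nil,
        firstPlayerEdges_cons, secondPlayerEdges_cons]
      tauto
  subst hx
  have move2 : promisingStrategy b c d e f (P 2) = s(c, f) := by rw [hP2]; exact if_pos rfl
  have hP3 : P 3 = [s(c, e), s(b, e), s(c, f)] := by rw [hPred 2 rfl, move2, hP2]; rfl
  have legal2 : LegalFrom R B (P 2) s(c, f) := by
    rw [hP2]
    simp [LegalFrom]
    grind
  have threat2 : HasThreat (redAfter R (P 3)) (blueAfter B (P 3)) := by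
    rw [hP3]
    apply hasThreat_of_edges (p := a) (q := c) (r := b) (s := f) <;>
      simp [redAfter, blueAfter, firstPlayerEdges_nil, secondPlayerEdges_nil,
        firstPlayerEdges_cons, secondPlayerEdges_cons] <;> grind [Sym2.eq_swap]
  have reply3 := hτ 3 rfl ⟨s(b, f), by rw [hP3]; simp [LegalFrom]; grind⟩
  have hP4 := hPblue 3 rfl
  generalize τ (P 3) = x at reply3 hP4
  rw [hP3] at reply3 hP4
  replace hP4 : P 4 = [s(c, e), s(b, e), s(c, f), x] := hP4
  by_cases hx : x = s(b, f)
  swap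
  · have move4 : promisingStrategy b c d e f (P 4) = s(b, f) := by rw [hP4]; exact if_neg hx
    have hP5 : P 5 = [s(c, e), s(b, e), s(c, f), x, s(b, f)] := by
      rw [hPred 4 rfl, move4, hP4]; rfl
    refine ⟨5, by norm_num, rfl, ?_, ?_, ?_, ?_⟩
    · intro m hm hm2
      obtain rfl | rfl | rfl : m = 0 ∨ m = 2 ∨ m = 4 := by omega
      · rwa [move0]
      · rwa [move2]
      · rw [move4, hP4]
        simp [LegalFrom]
        grind
    · intro m hm2 hm
      obtain rfl | rfl : m = 0 ∨ m = 2 := by omega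
      · exact threat0
      · exact threat2
    · rw [hP5]
      apply hasK4_of_edges (p := a) (q := c) (r := b) (s := f) <;>
        simp [redAfter, secondPlayerEdges_nil,
          firstPlayerEdges_cons, secondPlayerEdges_cons] <;> grind [Sym2.eq_swap]
    · rw [hP5]
      refine blueSafe x reply3.2.1 ?_
      intro y
      simp [blueAfter, firstPlayerEdges_nil,
        firstPlayerEdges_cons, secondPlayerEdges_cons]
      tauto
  subst hx
  have move4 : promisingStrategy b c d e f (P 4) = s(c, d) := by rw [hP4]; exact if_pos rfl
  have hP5 : P 5 = [s(c, e), s(b, e), s(c, f), s(b, f), s(c, d)] := by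
    rw [hPred 4 rfl, move4, hP4]; rfl
  have legal4 : LegalFrom R B (P 4) s(c, d) := by
    rw [hP4]
    simp [LegalFrom]
    grind
  have threat4 : HasThreat (redAfter R (P 5)) (blueAfter B (P 5)) := by
    rw [hP5]
    apply hasThreat_of_edges (p := a) (q := c) (r := d) (s := e) <;>
      simp [redAfter, blueAfter, firstPlayerEdges_nil, secondPlayerEdges_nil,
        firstPlayerEdges_cons, secondPlayerEdges_cons] <;> grind [Sym2.eq_swap]
  have reply5 := hτ 5 rfl ⟨s(d, e), by rw [hP5]; simp [LegalFrom]; grind⟩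
  have hP6 := hPblue 5 rfl
  generalize τ (P 5) = x at reply5 hP6
  rw [hP5] at reply5 hP6
  replace hP6 : P 6 = [s(c, e), s(b, e), s(c, f), s(b, f), s(c, d), x] := hP6
  obtain ⟨g, hg, hgx, move6⟩ : ∃ g, (g = e ∨ g = f) ∧ x ≠ s(d, g) ∧
      promisingStrategy b c d e f (P 6) = s(d, g) := by
    rw [hP6]
    by_cases hx : x = s(d, e)
    · exact ⟨f, Or.inr rfl, by rw [hx]; simp; grind, if_pos hx⟩
    · exact ⟨e, Or.inl rfl, hx, if_neg hx⟩
  have hP7 : P 7 = [s(c, e), s(b, e), s(c, f), s(b, f), s(c, d), x, s(d, g)] := by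
    rw [hPred 6 rfl, move6, hP6]; rfl
  refine ⟨7, le_rfl, rfl, ?_, ?_, ?_, ?_⟩
  · intro m hm hm2
    obtain rfl | rfl | rfl | rfl : m = 0 ∨ m = 2 ∨ m = 4 ∨ m = 6 := by omega
    · rwa [move0]
    · rwa [move2]
    · rwa [move4]
    · rw [move6, hP6]
      simp [LegalFrom]
      grind
  · intro m hm2 hm
    obtain rfl | rfl | rfl : m = 0 ∨ m = 2 ∨ m = 4 := by omega
    · exact threat0
    · exact threat2
    · exact threat4
  · rw [hP7]
    apply hasK4_of_edges (p := a) (q := c) (r := d) (s := g) <;>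
      simp [redAfter, secondPlayerEdges_nil,
        firstPlayerEdges_cons, secondPlayerEdges_cons] <;> grind [Sym2.eq_swap]
  · rw [hP7]
    refine blueSafe x reply5.2.1 ?_
    intro y
    simp [blueAfter, firstPlayerEdges_nil,
      firstPlayerEdges_cons, secondPlayerEdges_cons]
    tauto
end

section
/- In any position of the K^4-building game in which it is the second player's turn, the blue edges contain no completed K^4 and admit no blue threat, while the red edges admit two threats whose unclaimed missing edges are distinct, the first player wins: whatever unclaimed edge the second player claims, he does not complete a blue K^4, and the first player can then claim an unclaimed edge completing a red K^4. -/
/-- Claiming the missing edge of a threat completes a `K^4`. -/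
theorem IsThreat.hasK4_union {C O : Set (Sym2 ℕ)} {t : Finset ℕ} {x : Sym2 ℕ}
    (h : IsThreat C O t x) : HasK4 (C ∪ {x}) := by
  obtain ⟨ht, -, -, -, hC⟩ := h
  refine ⟨t, ht, fun u hu v hv huv => ?_⟩
  by_cases hx : s(u, v) = x
  · exact Or.inr hx
  · exact Or.inl (hC u hu v hv huv hx)

/-- The missing edge of a threat is a proper edge. -/
theorem IsThreat.not_isDiag {C O : Set (Sym2 ℕ)} {t : Finset ℕ} {x : Sym2 ℕ}
    (h : IsThreat C O t x) : ¬ x.IsDiag := by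
  obtain ⟨-, ⟨u, -, v, -, huv, rfl⟩, -⟩ := h
  simpa using huv

/-- If claiming an unclaimed edge completes a `K^4`, then either there already was one, or there
was a threat. -/
theorem HasK4.hasK4_or_hasThreat {C O : Set (Sym2 ℕ)} {x : Sym2 ℕ} (hxC : x ∉ C) (hxO : x ∉ O)
    (h : HasK4 (C ∪ {x})) : HasK4 C ∨ HasThreat C O := by
  obtain ⟨t, ht, hE⟩ := h
  have hC : ∀ u ∈ t, ∀ v ∈ t, u ≠ v → s(u, v) ≠ x → s(u, v) ∈ C :=
    fun u hu v hv huv hx => (hE u hu v hv huv).resolve_right hx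
  by_cases hx : ∃ u ∈ t, ∃ v ∈ t, u ≠ v ∧ x = s(u, v)
  · exact Or.inr ⟨t, x, ht, hx, hxC, hxO, hC⟩
  · exact Or.inl ⟨t, ht, fun u hu v hv huv =>
      hC u hu v hv huv fun h => hx ⟨u, hu, v, hv, huv, h.symm⟩⟩

/-- The double-threat principle.  In any position `(R, B)` of the
`K^4`-building game in which it is the second player's turn, the blue edges
contain no completed `K^4` and admit no blue threat, while the red edges admit
two threats whose unclaimed missing edges are distinct, the first player wins:
whatever unclaimed edge the second player claims, he does not complete a blue
`K^4`, and the first player can then claim an unclaimed edge completing a red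
`K^4`. -/
theorem double_threat_wins
    (R B : Finset (Sym2 ℕ)) (hdisj : Disjoint R B)
    (hnoblueK4 : ¬ HasK4 ↑B)
    (hnobluethreat : ¬ HasThreat ↑B ↑R)
    (t₁ t₂ : Finset ℕ) (x₁ x₂ : Sym2 ℕ)
    (h₁ : IsThreat ↑R ↑B t₁ x₁) (h₂ : IsThreat ↑R ↑B t₂ x₂)
    (hne : x₁ ≠ x₂) :
    ∀ x : Sym2 ℕ, ¬ x.IsDiag → x ∉ R → x ∉ B →
      ¬ HasK4 (↑B ∪ {x}) ∧
      ∃ y : Sym2 ℕ, ¬ y.IsDiag ∧ y ∉ R ∧ y ∉ B ∧ y ≠ x ∧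
        HasK4 (↑R ∪ {y}) := by
  intro x _ hxR hxB
  refine ⟨fun h => (h.hasK4_or_hasThreat hxB hxR).elim hnoblueK4 hnobluethreat, ?_⟩
  by_cases hx : x₁ = x
  · exact ⟨x₂, h₂.not_isDiag, h₂.2.2.1, h₂.2.2.2.1, fun h => hne (hx.trans h.symm),
      h₂.hasK4_union⟩
  · exact ⟨x₁, h₁.not_isDiag, h₁.2.2.1, h₁.2.2.2.1, hx, h₁.hasK4_union⟩
end
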